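/- There exists a constant C > 0 such that for every t ≥ 0 and every x ∈ ℝ, the second derivative of the flow with respect to the initial value satisfies |∂²_x Φ_t(x)| ≤ exp(C·t)·|x|. -/

import Mathlib

/-- `D t x = x² + (1 − x²)·exp(−2t)`. -/
noncomputable def D (t x : ℝ) : ℝ := x ^ 2 + (1 - x ^ 2) * Real.exp (-2 * t)

/-- The flow `Φ_t(x) = x / √(D t x)` of the ODE `x' = x − x³`. -/
noncomputable def Phi (t x : ℝ) : ℝ := x / Real.sqrt (D t x)

theorem D_eq (t x : ℝ) :
    D t x = (1 - Real.exp (-2 * t)) * x ^ 2 + Real.exp (-2 * t) := by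
  unfold D; ring

theorem exp_le_D {t : ℝ} (ht : 0 ≤ t) (x : ℝ) : Real.exp (-2 * t) ≤ D t x := by
  have h : Real.exp (-2 * t) ≤ 1 := Real.exp_le_one_iff.mpr (by linarith)
  rw [D_eq]
  nlinarith [mul_nonneg (sub_nonneg.mpr h) (sq_nonneg x)]

theorem D_pos {t : ℝ} (ht : 0 ≤ t) (x : ℝ) : 0 < D t x :=
  (Real.exp_pos _).trans_le (exp_le_D ht x)

theorem exp_neg_le_sqrt_D {t : ℝ} (ht : 0 ≤ t) (x : ℝ) :
    Real.exp (-t) ≤ Real.sqrt (D t x) := by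
  refine Real.le_sqrt_of_sq_le ((exp_le_D ht x).trans' (le_of_eq ?_))
  rw [← Real.exp_nat_mul]
  congr 1
  push_cast
  ring

theorem hasDerivAt_sqrt_D {t : ℝ} (ht : 0 ≤ t) (x : ℝ) :
    HasDerivAt (fun y => Real.sqrt (D t y))
      ((1 - Real.exp (-2 * t)) * x / Real.sqrt (D t x)) x := by
  have hD : HasDerivAt (fun y => D t y) ((1 - Real.exp (-2 * t)) * (2 * x)) x := by
    simp only [D_eq]
    simpa using (((hasDerivAt_id x).pow 2).const_mul (1 - Real.exp (-2 * t))).add_const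
      (Real.exp (-2 * t))
  convert hD.sqrt (D_pos ht x).ne' using 1
  have := Real.sqrt_pos.mpr (D_pos ht x)
  field_simp

theorem hasDerivAt_Phi {t : ℝ} (ht : 0 ≤ t) (x : ℝ) :
    HasDerivAt (fun y => Phi t y) (Real.exp (-2 * t) / Real.sqrt (D t x) ^ 3) x := by
  have hr := Real.sqrt_pos.mpr (D_pos ht x)
  refine ((hasDerivAt_id x).div (hasDerivAt_sqrt_D ht x) hr.ne').congr_deriv ?_
  have hs := (Real.sq_sqrt (D_pos ht x).le).trans (D_eq t x)
  field_simp
  simp only [id, neg_mul] at hs ⊢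
  linear_combination hs

theorem hasDerivAt_deriv_Phi {t : ℝ} (ht : 0 ≤ t) (x : ℝ) :
    HasDerivAt (deriv fun y => Phi t y)
      (-(3 * Real.exp (-2 * t) * (1 - Real.exp (-2 * t))) / Real.sqrt (D t x) ^ 5 * x) x := by
  have hr := Real.sqrt_pos.mpr (D_pos ht x)
  rw [funext fun y => (hasDerivAt_Phi ht y).deriv]
  refine ((hasDerivAt_const x (Real.exp (-2 * t))).div
    ((hasDerivAt_sqrt_D ht x).pow 3) (pow_pos hr 3).ne').congr_deriv ?_
  simp
  field_simp

/-- There is `C > 0` with `|∂²_x Φ_t(x)| ≤ exp(C·t)·|x|` for all `t ≥ 0`, `x ∈ ℝ`. -/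
theorem phi_second_deriv_bound :
    ∃ C : ℝ, 0 < C ∧ ∀ t : ℝ, 0 ≤ t → ∀ x : ℝ,
      |deriv (deriv (fun y => Phi t y)) x| ≤ Real.exp (C * t) * |x| := by
  refine ⟨9, by norm_num, fun t ht x => ?_⟩
  rw [(hasDerivAt_deriv_Phi ht x).deriv, abs_mul]
  refine mul_le_mul_of_nonneg_right ?_ (abs_nonneg x)
  have hE : Real.exp (-2 * t) ≤ 1 := Real.exp_le_one_iff.mpr (by linarith)
  have hr := Real.sqrt_pos.mpr (D_pos ht x)
  rw [neg_div, abs_neg, abs_of_nonneg (div_nonneg (mul_nonneg (by positivity) (by linarith))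
    (by positivity)), div_le_iff₀ (by positivity)]
  have hlin : 3 * (1 - Real.exp (-2 * t)) ≤ Real.exp (6 * t) := by
    linarith [Real.add_one_le_exp (-2 * t), Real.add_one_le_exp (6 * t)]
  calc 3 * Real.exp (-2 * t) * (1 - Real.exp (-2 * t))
      = 3 * (1 - Real.exp (-2 * t)) * Real.exp (-2 * t) := by ring
    _ ≤ Real.exp (6 * t) * Real.exp (-2 * t) := by gcongr
    _ = Real.exp (9 * t) * Real.exp (-t) ^ 5 := by
      rw [← Real.exp_nat_mul, ← Real.exp_add, ← Real.exp_add]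
      congr 1
      push_cast
      ring
    _ ≤ Real.exp (9 * t) * Real.sqrt (D t x) ^ 5 := by
      gcongr
      exact exp_neg_le_sqrt_D ht x
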